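/- Let u ∈ L^∞((0,T)×D;ℝ^m) take values a.e. in a compact set C ⊂ ℝ^m, let u₀ ∈ L^∞(D;ℝ^m), and assume u is a weak solution with initial data u₀ satisfying the entropy inequality (both in the distributional sense against smooth test functions compactly supported in time, as in the relative entropy framework). Let v : [0,T]×D → ℝ^m be a Lipschitz reconstruction with square-integrable residual R := ∂_t v + ∂_x f(v). Then for a.e. s ∈ (0,T) the following pre-Gronwall relative entropy inequality holds: ∫_D η(u(s,x)|v(s,x)) dx ≤ − ∫_0^s ∫_D f(u(t,x)|v(t,x)) · ( D²η(v(t,x)) ∂_x v(t,x) ) dx dt − ∫_0^s ∫_D ( u(t,x) − v(t,x) ) · ( D²η(v(t,x)) R(t,x) ) dx dt + ∫_D η(u₀(x)|v(0,x)) dx. -/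

import Mathlib

open MeasureTheory Set
open scoped ENNReal RealInnerProductSpace


open Filter Topology ContDiff Convolution in
theorem aux_mollify {E : Type*} [NormedAddCommGroup E] [NormedSpace ℝ E] [FiniteDimensional ℝ E]
    (W : ℝ × ℝ → E) (K : NNReal) (hW : LipschitzWith K W) (B : ℝ) (hB : ∀ p, ‖W p‖ ≤ B)
    (hper : ∀ t x, W (t, x + 1) = W (t, x)) :
    ∃ w : ℕ → ℝ × ℝ → E, (∀ n, ContDiff ℝ (⊤:ℕ∞) (w n)) ∧
      (∀ n t x, w n (t, x + 1) = w n (t, x)) ∧ (∀ n p, ‖w n p‖ ≤ B) ∧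
      (∀ n p, ‖fderiv ℝ (w n) p‖ ≤ K) ∧ (∀ p, Tendsto (fun n => w n p) atTop (𝓝 (W p))) ∧
      (∀ᵐ p, Tendsto (fun n => fderiv ℝ (w n) p) atTop (𝓝 (fderiv ℝ W p))) := by
  have : CompleteSpace E := FiniteDimensional.complete ℝ E
  borelize E
  have : BorelSpace ((ℝ × ℝ) →L[ℝ] E) := ⟨rfl⟩
  let φ : ℕ → ContDiffBump (0 : ℝ × ℝ) := fun n =>
    { rIn := 1 / ((n:ℝ) + 1)
      rOut := 2 * (1 / ((n:ℝ) + 1))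
      rIn_pos := by positivity
      rIn_lt_rOut := by have : 0 < 1 / ((n:ℝ) + 1) := by positivity
                        linarith }
  have hφ : Tendsto (fun n => (φ n).rOut) atTop (𝓝 0) := by
    have := (tendsto_one_div_add_atTop_nhds_zero_nat (𝕜 := ℝ)).const_mul 2
    simpa [φ] using this
  let ρ : ℕ → ℝ × ℝ → ℝ := fun n => (φ n).normed volume
  have hWc : Continuous W := hW.continuous
  have hli : LocallyIntegrable W volume := hWc.locallyIntegrable
  have hmeas : Measurable (fderiv ℝ W) := measurable_fderiv ℝ W
  have hbd : ∀ p, ‖fderiv ℝ W p‖ ≤ K := fun p => norm_fderiv_le_of_lipschitz ℝ hW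
  have hdW : LocallyIntegrable (fderiv ℝ W) volume := by
    apply LocallyIntegrable.mono (f := fun _ => (K:ℝ)) (locallyIntegrable_const _)
      hmeas.aestronglyMeasurable
    refine Eventually.of_forall fun p => ?_
    simpa using hbd p
  let w : ℕ → ℝ × ℝ → E := fun n => (ρ n) ⋆[ContinuousLinearMap.lsmul ℝ ℝ, volume] W
  have hwdef : ∀ n p, w n p = ∫ y, ρ n y • W (p - y) := fun n p => by
    simp [w, convolution_def]
  have hint : ∀ n, Integrable (ρ n) volume := fun n => (φ n).integrable_normed
  have hnn : ∀ n y, 0 ≤ ρ n y := fun n y => (φ n).nonneg_normed y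
  have hone : ∀ n, ∫ y, ρ n y = 1 := fun n => (φ n).integral_normed
  have hder : ∀ n p, HasFDerivAt (w n) (∫ y, ρ n y • fderiv ℝ W (p - y)) p := by
    intro n p
    have key := hasFDerivAt_integral_of_dominated_loc_of_lip' (μ := (volume : Measure (ℝ × ℝ)))
      (F := fun p y => ρ n y • W (p - y)) (F' := fun y => ρ n y • fderiv ℝ W (p - y))
      (x₀ := p) (s := univ) (bound := fun y => ρ n y * K) (𝕜 := ℝ) univ_mem ?_ ?_ ?_ ?_ ?_ ?_
    · have := key.2
      have e : w n = fun x => ∫ a, ρ n a • W (x - a) := funext (hwdef n)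
      rw [e]; exact this
    · intro x _
      exact ((φ n).continuous_normed.smul (hWc.comp (by fun_prop))).aestronglyMeasurable
    · refine ((hint n).mul_const B).mono'
        ((φ n).continuous_normed.smul (hWc.comp (by fun_prop))).aestronglyMeasurable ?_
      refine Eventually.of_forall fun y => ?_
      rw [norm_smul, Real.norm_of_nonneg (hnn n y)]
      exact mul_le_mul_of_nonneg_left (hB _) (hnn n y)
    · exact (φ n).continuous_normed.aestronglyMeasurable.smul
        (hmeas.comp (measurable_const.sub measurable_id)).aestronglyMeasurable
    · refine Eventually.of_forall fun y x _ => ?_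
      rw [← smul_sub, norm_smul, Real.norm_of_nonneg (hnn n y), mul_assoc]
      refine mul_le_mul_of_nonneg_left ?_ (hnn n y)
      have := hW.norm_sub_le (x - y) (p - y)
      simpa using this
    · exact (hint n).mul_const _
    · have h1 : ∀ᵐ y : ℝ × ℝ, DifferentiableAt ℝ W y := hW.ae_differentiableAt
      have h2 : ∀ᵐ y : ℝ × ℝ, DifferentiableAt ℝ W (p - y) :=
        (quasiMeasurePreserving_sub_left volume p).ae h1
      filter_upwards [h2] with y hy
      have : HasFDerivAt (fun x => W (x - y)) (fderiv ℝ W (p - y)) p := by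
        have := hy.hasFDerivAt.comp p ((hasFDerivAt_id p).sub_const y)
        simpa [Function.comp_def] using this
      exact this.const_smul (ρ n y)
  refine ⟨w, ?_, ?_, ?_, ?_, ?_, ?_⟩
  · intro n
    exact (φ n).hasCompactSupport_normed.contDiff_convolution_left _
      (φ n).contDiff_normed hli
  · intro n t x
    rw [hwdef, hwdef]
    congr 1; ext y
    have : ((t, x + 1) : ℝ × ℝ) - y = (t - y.1, (x - y.2) + 1) := by
      ext <;> simp; ring
    rw [this, hper]; rfl
  · intro n p
    rw [hwdef]
    calc _ ≤ ∫ y, ρ n y * B := by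
          refine norm_integral_le_of_norm_le ((hint n).mul_const B) (Eventually.of_forall fun y => ?_)
          rw [norm_smul, Real.norm_of_nonneg (hnn n y)]
          exact mul_le_mul_of_nonneg_left (hB _) (hnn n y)
      _ = B := by rw [integral_mul_const, hone, one_mul]
  · intro n p
    rw [(hder n p).fderiv]
    calc _ ≤ ∫ y, ρ n y * K := by
          refine norm_integral_le_of_norm_le ((hint n).mul_const _) (Eventually.of_forall fun y => ?_)
          rw [norm_smul, Real.norm_of_nonneg (hnn n y)]
          exact mul_le_mul_of_nonneg_left (hbd _) (hnn n y)
      _ = K := by rw [integral_mul_const, hone, one_mul]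
  · intro p
    exact ContDiffBump.convolution_tendsto_right_of_continuous hφ hWc p
  · have := ContDiffBump.ae_convolution_tendsto_right_of_locallyIntegrable (φ := φ) (K := 2)
      hφ (Eventually.of_forall fun n => le_rfl) hdW
    filter_upwards [this] with p hp
    refine hp.congr fun n => ?_
    rw [(hder n p).fderiv, convolution_def]
    simp [ρ]

theorem aux_lip_comp {E F : Type*} [NormedAddCommGroup E] [NormedSpace ℝ E] [FiniteDimensional ℝ E]
    [NormedAddCommGroup F] [NormedSpace ℝ F] {X : Type*} [PseudoEMetricSpace X]
    (V : X → E) (L : NNReal) (hV : LipschitzWith L V) (B : ℝ) (hB : ∀ p, ‖V p‖ ≤ B)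
    (G : E → F) (hG : ContDiff ℝ 1 G) :
    ∃ K : NNReal, LipschitzWith K (fun p => G (V p)) := by
  obtain ⟨K, hK⟩ := LocallyLipschitzOn.exists_lipschitzOnWith_of_compact
    (isCompact_closedBall (0:E) B) (hG.locallyLipschitz.locallyLipschitzOn (s := Metric.closedBall 0 B))
  refine ⟨K * L, ?_⟩
  rw [← lipschitzOnWith_univ] at hV ⊢
  exact hK.comp hV (fun p _ => by simpa using hB p)

theorem aux_int {Y Ω F : Type*} [NormedAddCommGroup F] [TopologicalSpace Y] [MeasurableSpace Ω] (μ : Measure Ω)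
    [IsFiniteMeasure μ] (X : Ω → Y) (hX : AEStronglyMeasurable X μ) (S : Set Y) (hS : IsCompact S)
    (hXS : ∀ᵐ p ∂μ, X p ∈ S) (Φ : Y → F) (hΦ : Continuous Φ) :
    Integrable (fun p => Φ (X p)) μ := by
  obtain ⟨M, hM⟩ := hS.exists_bound_of_continuousOn hΦ.continuousOn
  exact Integrable.of_bound (hΦ.comp_aestronglyMeasurable hX) M (hXS.mono fun p hp => hM _ hp)


open Filter Topology in
theorem aux_weak {E : Type*} [NormedAddCommGroup E] [InnerProductSpace ℝ E] [FiniteDimensional ℝ E]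
    {T : ℝ} (a b : ℝ × ℝ → E) (c : ℝ → E)
    (ha : Integrable a ((volume.restrict (Ioo 0 T)).prod (volume.restrict (Ioo (0:ℝ) 1))))
    (hb : Integrable b ((volume.restrict (Ioo 0 T)).prod (volume.restrict (Ioo (0:ℝ) 1))))
    (hc : Integrable c (volume.restrict (Ioo (0:ℝ) 1)))
    (hweak : ∀ φ : ℝ → ℝ → E,
      ContDiff ℝ (⊤:ℕ∞) (fun p : ℝ × ℝ => φ p.1 p.2) →
      (∀ t x, φ t (x + 1) = φ t x) →
      (∃ t₀ < T, ∀ t, t₀ ≤ t → ∀ x, φ t x = 0) →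
      (∫ t in Ioo 0 T, ∫ x in Ioo (0:ℝ) 1,
          (⟪a (t, x), deriv (fun s => φ s x) t⟫ + ⟪b (t, x), deriv (fun y => φ t y) x⟫))
        + (∫ x in Ioo (0:ℝ) 1, ⟪c x, φ 0 x⟫) = 0)
    (θ : ℝ → ℝ) (hθ : ContDiff ℝ (⊤:ℕ∞) θ) (hθ0 : ∃ t₀ < T, ∀ t, t₀ ≤ t → θ t = 0)
    (W : ℝ × ℝ → E) (K : NNReal) (hW : LipschitzWith K W) (B : ℝ) (hB : ∀ p, ‖W p‖ ≤ B)
    (hper : ∀ t x, W (t, x + 1) = W (t, x)) :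
    (∫ p, (⟪a p, deriv θ p.1 • W p + θ p.1 • fderiv ℝ W p (1, 0)⟫
        + ⟪b p, θ p.1 • fderiv ℝ W p (0, 1)⟫)
        ∂((volume.restrict (Ioo 0 T)).prod (volume.restrict (Ioo (0:ℝ) 1))))
      + ∫ x in Ioo (0:ℝ) 1, ⟪c x, θ 0 • W (0, x)⟫ = 0 := by
  borelize E
  set μ := (volume.restrict (Ioo 0 T)).prod (volume.restrict (Ioo (0:ℝ) 1)) with hμ
  obtain ⟨w, hw1, hw2, hw3, hw4, hw5, hw6⟩ := aux_mollify W K hW B hB hper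
  have hθ' : Continuous (deriv θ) := hθ.continuous_deriv (by simp)
  obtain ⟨M1, hM1⟩ := (isCompact_Icc (a := (0:ℝ)) (b := T)).exists_bound_of_continuousOn
    hθ.continuous.continuousOn
  obtain ⟨M2, hM2⟩ := (isCompact_Icc (a := (0:ℝ)) (b := T)).exists_bound_of_continuousOn
    hθ'.continuousOn
  have hmem : ∀ᵐ p ∂μ, p.1 ∈ Icc 0 T := by
    rw [hμ, Measure.prod_restrict]
    filter_upwards [ae_restrict_mem (measurableSet_Ioo.prod measurableSet_Ioo)] with p hp
    exact Ioo_subset_Icc_self hp.1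
  have habs : μ ≪ (volume : Measure (ℝ × ℝ)) := by
    rw [hμ, Measure.prod_restrict, ← Measure.volume_eq_prod]
    exact Measure.absolutelyContinuous_of_le Measure.restrict_le_self
  have hn1 : ‖((1:ℝ), (0:ℝ))‖ = 1 := by simp [Prod.norm_def]
  have hn2 : ‖((0:ℝ), (1:ℝ))‖ = 1 := by simp [Prod.norm_def]
  have hwd1 : ∀ n p, ‖fderiv ℝ (w n) p (1, 0)‖ ≤ K := fun n p => by
    have := (fderiv ℝ (w n) p).le_opNorm (1, 0)
    rw [hn1, mul_one] at this; exact this.trans (hw4 n p)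
  have hwd2 : ∀ n p, ‖fderiv ℝ (w n) p (0, 1)‖ ≤ K := fun n p => by
    have := (fderiv ℝ (w n) p).le_opNorm (0, 1)
    rw [hn2, mul_one] at this; exact this.trans (hw4 n p)
  let F : ℕ → ℝ × ℝ → ℝ := fun n p =>
    ⟪a p, deriv θ p.1 • w n p + θ p.1 • fderiv ℝ (w n) p (1, 0)⟫
        + ⟪b p, θ p.1 • fderiv ℝ (w n) p (0, 1)⟫
  let bd : ℝ × ℝ → ℝ := fun p => ‖a p‖ * (M2 * B + M1 * K) + ‖b p‖ * (M1 * K)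
  have hbd : Integrable bd μ := (ha.norm.mul_const _).add (hb.norm.mul_const _)
  have hFm : ∀ n, AEStronglyMeasurable (F n) μ := by
    intro n
    have c0 := (hw1 n).continuous
    have c1 : Continuous (fderiv ℝ (w n)) := (hw1 n).continuous_fderiv (by simp)
    have cθ := hθ.continuous
    refine (ha.1.inner (Continuous.aestronglyMeasurable ?_)).add
      (hb.1.inner (Continuous.aestronglyMeasurable ?_))
    · fun_prop
    · fun_prop
  have hFb : ∀ n, ∀ᵐ p ∂μ, ‖F n p‖ ≤ bd p := by
    intro n
    filter_upwards [hmem] with p hp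
    have h1 := hM1 _ hp
    have h2 := hM2 _ hp
    have hM1' : 0 ≤ M1 := (norm_nonneg _).trans h1
    have hM2' : 0 ≤ M2 := (norm_nonneg _).trans h2
    refine (norm_add_le _ _).trans (add_le_add ?_ ?_)
    · refine (norm_inner_le_norm _ _).trans (mul_le_mul_of_nonneg_left ?_ (norm_nonneg _))
      refine (norm_add_le _ _).trans (add_le_add ?_ ?_)
      · rw [norm_smul]; exact mul_le_mul h2 (hw3 n p) (norm_nonneg _) hM2'
      · rw [norm_smul]; exact mul_le_mul h1 (hwd1 n p) (norm_nonneg _) hM1'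
    · refine (norm_inner_le_norm _ _).trans (mul_le_mul_of_nonneg_left ?_ (norm_nonneg _))
      rw [norm_smul]; exact mul_le_mul h1 (hwd2 n p) (norm_nonneg _) hM1'
  have hFi : ∀ n, Integrable (F n) μ := fun n => hbd.mono' (hFm n) (hFb n)
  have heq : ∀ n, (∫ p, F n p ∂μ) + ∫ x in Ioo (0:ℝ) 1, ⟪c x, θ 0 • w n (0, x)⟫ = 0 := by
    intro n
    have h := hweak (fun t x => θ t • w n (t, x)) ?_ ?_ ?_
    · rw [hμ, integral_prod (F n) (hFi n)]
      refine Eq.trans ?_ h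
      refine congrArg₂ (· + ·) ?_ rfl
      refine integral_congr_ae (Eventually.of_forall fun t => ?_)
      refine integral_congr_ae (Eventually.of_forall fun x => ?_)
      have hd : HasFDerivAt (w n) (fderiv ℝ (w n) (t, x)) (t, x) :=
        ((hw1 n).differentiable (by simp) (t, x)).hasFDerivAt
      have e1 : HasDerivAt (fun s => w n (s, x)) (fderiv ℝ (w n) (t, x) (1, 0)) t :=
        hd.comp_hasDerivAt t ((hasDerivAt_id t).prodMk (hasDerivAt_const t x))
      have e2 : HasDerivAt (fun y => w n (t, y)) (fderiv ℝ (w n) (t, x) (0, 1)) x :=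
        hd.comp_hasDerivAt x ((hasDerivAt_const x t).prodMk (hasDerivAt_id x))
      have e3 : HasDerivAt θ (deriv θ t) t := (hθ.differentiable (by simp) t).hasDerivAt
      simp only [F]
      rw [(e3.fun_smul e1).deriv, (e2.fun_const_smul (θ t)).deriv, add_comm (deriv θ t • _)]
    · have := hw1 n
      exact (hθ.comp contDiff_fst).smul this
    · intro t x; simp only [hw2]
    · obtain ⟨t₀, h1, h2⟩ := hθ0
      exact ⟨t₀, h1, fun t ht x => by simp [h2 t ht]⟩
  have hl1 : Tendsto (fun n => ∫ p, F n p ∂μ) atTop (𝓝 (∫ p,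
      (⟪a p, deriv θ p.1 • W p + θ p.1 • fderiv ℝ W p (1, 0)⟫
        + ⟪b p, θ p.1 • fderiv ℝ W p (0, 1)⟫) ∂μ)) := by
    refine tendsto_integral_of_dominated_convergence bd hFm hbd hFb ?_
    filter_upwards [habs.ae_le hw6] with p hp
    have t1 : Tendsto (fun n => fderiv ℝ (w n) p (1, 0)) atTop (𝓝 (fderiv ℝ W p (1, 0))) :=
      ((ContinuousLinearMap.apply ℝ E ((1:ℝ), (0:ℝ))).continuous.tendsto _).comp hp
    have t2 : Tendsto (fun n => fderiv ℝ (w n) p (0, 1)) atTop (𝓝 (fderiv ℝ W p (0, 1))) :=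
      ((ContinuousLinearMap.apply ℝ E ((0:ℝ), (1:ℝ))).continuous.tendsto _).comp hp
    exact (tendsto_const_nhds.inner (((hw5 p).const_smul _).add (t1.const_smul _))).add
      (tendsto_const_nhds.inner (t2.const_smul _))
  have hl2 : Tendsto (fun n => ∫ x in Ioo (0:ℝ) 1, ⟪c x, θ 0 • w n (0, x)⟫) atTop
      (𝓝 (∫ x in Ioo (0:ℝ) 1, ⟪c x, θ 0 • W (0, x)⟫)) := by
    refine tendsto_integral_of_dominated_convergence (fun x => ‖c x‖ * (‖θ 0‖ * B)) ?_
      (hc.norm.mul_const _) ?_ ?_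
    · intro n
      have c0 := (hw1 n).continuous
      exact hc.1.inner (Continuous.aestronglyMeasurable (by fun_prop))
    · intro n
      refine Eventually.of_forall fun x => ?_
      refine (norm_inner_le_norm _ _).trans (mul_le_mul_of_nonneg_left ?_ (norm_nonneg _))
      rw [norm_smul]; exact mul_le_mul_of_nonneg_left (hw3 n _) (norm_nonneg _)
    · refine Eventually.of_forall fun x => ?_
      exact tendsto_const_nhds.inner ((hw5 _).const_smul _)
  refine tendsto_nhds_unique (hl1.add hl2) ?_
  simp only [heq]
  exact tendsto_const_nhds


open Filter Topology in
theorem aux_t {T : ℝ} (hT : 0 < T) (θ : ℝ → ℝ) (hθ : ContDiff ℝ (⊤:ℕ∞) θ) (hθT : θ T = 0)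
    (P : ℝ × ℝ → ℝ) (K : NNReal) (hP : LipschitzWith K P)
    (hi : Integrable (fun p => deriv θ p.1 * P p + θ p.1 * fderiv ℝ P p (1, 0))
      ((volume.restrict (Ioo 0 T)).prod (volume.restrict (Ioo (0:ℝ) 1)))) :
    ∫ p, (deriv θ p.1 * P p + θ p.1 * fderiv ℝ P p (1, 0))
        ∂((volume.restrict (Ioo 0 T)).prod (volume.restrict (Ioo (0:ℝ) 1)))
      = - ∫ x in Ioo (0:ℝ) 1, θ 0 * P (0, x) := by
  rw [integral_prod_symm _ hi, ← integral_neg]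
  refine integral_congr_ae ?_
  have h1 : ∀ᵐ p : ℝ × ℝ, DifferentiableAt ℝ P p := hP.ae_differentiableAt
  have h2 : ∀ᵐ p : ℝ × ℝ, DifferentiableAt ℝ P p.swap :=
    (Measure.measurePreserving_swap (μ := (volume : Measure ℝ)) (ν := (volume : Measure ℝ))).quasiMeasurePreserving.ae h1
  have h3 : ∀ᵐ x : ℝ, ∀ᵐ t : ℝ, DifferentiableAt ℝ P (t, x) := Measure.ae_ae_of_ae_prod h2
  filter_upwards [ae_restrict_of_ae h3] with x hx
  have hL : LipschitzWith K (fun t => P (t, x)) := by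
    have := hP.comp (LipschitzWith.prodMk_right (α := ℝ) x)
    simpa [Function.comp_def] using this
  have hac : AbsolutelyContinuousOnInterval (fun t => P (t, x)) 0 T :=
    (hL.lipschitzOnWith (s := uIcc 0 T)).absolutelyContinuousOnInterval
  have hacθ : AbsolutelyContinuousOnInterval θ 0 T :=
    ContDiffOn.absolutelyContinuousOnInterval ((hθ.of_le (by simp)).contDiffOn)
  have key := hacθ.integral_deriv_mul_eq_sub hac
  rw [hθT, zero_mul, zero_sub, intervalIntegral.integral_of_le hT.le, integral_Ioc_eq_integral_Ioo]
    at key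
  rw [← key]
  refine integral_congr_ae ?_
  filter_upwards [ae_restrict_of_ae hx] with t ht
  have e1 : HasDerivAt (fun s => P (s, x)) (fderiv ℝ P (t, x) (1, 0)) t :=
    ht.hasFDerivAt.comp_hasDerivAt t ((hasDerivAt_id t).prodMk (hasDerivAt_const t x))
  simp only [e1.deriv]

open Filter Topology in
theorem aux_x {T : ℝ} (θ : ℝ → ℝ)
    (P : ℝ × ℝ → ℝ) (K : NNReal) (hP : LipschitzWith K P)
    (hper : ∀ t x, P (t, x + 1) = P (t, x))
    (hi : Integrable (fun p => θ p.1 * fderiv ℝ P p (0, 1))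
      ((volume.restrict (Ioo 0 T)).prod (volume.restrict (Ioo (0:ℝ) 1)))) :
    ∫ p, (θ p.1 * fderiv ℝ P p (0, 1))
        ∂((volume.restrict (Ioo 0 T)).prod (volume.restrict (Ioo (0:ℝ) 1))) = 0 := by
  rw [integral_prod _ hi]
  refine integral_eq_zero_of_ae ?_
  have h1 : ∀ᵐ p : ℝ × ℝ, DifferentiableAt ℝ P p := hP.ae_differentiableAt
  have h3 : ∀ᵐ t : ℝ, ∀ᵐ x : ℝ, DifferentiableAt ℝ P (t, x) := Measure.ae_ae_of_ae_prod h1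
  filter_upwards [ae_restrict_of_ae h3] with t hx
  have hL : LipschitzWith K (fun x => P (t, x)) := by
    have := hP.comp (LipschitzWith.prodMk_left (β := ℝ) t)
    simpa [Function.comp_def] using this
  have hac : AbsolutelyContinuousOnInterval (fun x => P (t, x)) 0 1 :=
    (hL.lipschitzOnWith (s := uIcc 0 1)).absolutelyContinuousOnInterval
  have key := hac.integral_deriv_eq_sub
  have h01 : P (t, 1) = P (t, 0) := by simpa using hper t 0
  rw [h01, sub_self, intervalIntegral.integral_of_le zero_le_one, integral_Ioc_eq_integral_Ioo]
    at key
  simp only [Pi.zero_apply]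
  rw [integral_const_mul]
  refine mul_eq_zero_of_right _ ?_
  refine Eq.trans ?_ key
  refine integral_congr_ae ?_
  filter_upwards [ae_restrict_of_ae hx] with x ht
  have e1 : HasDerivAt (fun s => P (t, s)) (fderiv ℝ P (t, x) (0, 1)) x :=
    ht.hasFDerivAt.comp_hasDerivAt x ((hasDerivAt_const x t).prodMk (hasDerivAt_id x))
  exact e1.deriv.symm

open Filter Topology Convolution in
theorem aux_final {T : ℝ} (hT : 0 < T) (A G : ℝ → ℝ) (A0 : ℝ)
    (hA : IntegrableOn A (Ioo 0 T)) (hG : IntegrableOn G (Ioo 0 T))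
    (h : ∀ θ : ℝ → ℝ, ContDiff ℝ (⊤:ℕ∞) θ → (∀ t, 0 ≤ θ t) →
      (∃ t₀ < T, ∀ t, t₀ ≤ t → θ t = 0) →
      ∫ t in Ioo 0 T, θ t * G t ≤ (∫ t in Ioo 0 T, deriv θ t * A t) + θ 0 * A0) :
    ∀ᵐ s ∂(volume.restrict (Ioo 0 T)), A s ≤ A0 - ∫ t in Ioo 0 s, G t := by
  have hGi : IntervalIntegrable G volume 0 T := by
    rw [intervalIntegrable_iff_integrableOn_Ioo_of_le hT.le]; exact hG
  let Γ : ℝ → ℝ := fun s => ∫ r in (0:ℝ)..s, G r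
  have hΓ : AbsolutelyContinuousOnInterval Γ 0 T :=
    hGi.absolutelyContinuousOnInterval_intervalIntegral (c := 0) (by simp)
  have hΓi : IntegrableOn Γ (Ioo 0 T) := by
    have := hΓ.continuousOn.integrableOn_compact (μ := volume) isCompact_uIcc
    rw [uIcc_of_le hT.le] at this
    exact this.mono_set Ioo_subset_Icc_self
  let H0 : ℝ → ℝ := fun s => A s - A0 + Γ s
  have hH0 : IntegrableOn H0 (Ioo 0 T) :=
    (hA.sub (integrableOn_const (by simp))).add hΓi
  let H : ℝ → ℝ := (Ioo 0 T).indicator H0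
  have hH : Integrable H := hH0.integrable_indicator measurableSet_Ioo
  -- main inequality
  have key : ∀ θ : ℝ → ℝ, ContDiff ℝ (⊤:ℕ∞) θ → (∀ t, 0 ≤ θ t) →
      (∃ t₀ < T, ∀ t, t₀ ≤ t → θ t = 0) → 0 ≤ ∫ t in Ioo 0 T, deriv θ t * H0 t := by
    intro θ hθ hθn hθ0
    have hmain := h θ hθ hθn hθ0
    have hθT : θ T = 0 := by
      obtain ⟨t₀, h1, h2⟩ := hθ0; exact h2 T h1.le
    have hacθ : AbsolutelyContinuousOnInterval θ 0 T :=
      ContDiffOn.absolutelyContinuousOnInterval ((hθ.of_le (by simp)).contDiffOn)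
    have hθ' : Continuous (deriv θ) := hθ.continuous_deriv (by simp)
    have hmul : ∀ (c g : ℝ → ℝ), Continuous c → IntegrableOn g (Ioo 0 T) →
        IntegrableOn (fun t => c t * g t) (Ioo 0 T) := by
      intro c g hc hg
      have : IntervalIntegrable g volume 0 T := by
        rw [intervalIntegrable_iff_integrableOn_Ioo_of_le hT.le]; exact hg
      have := this.continuousOn_mul hc.continuousOn
      rwa [intervalIntegrable_iff_integrableOn_Ioo_of_le hT.le] at this
    have i1 := hmul _ _ hθ' hA
    have i2 := hmul _ _ hθ' hΓi
    have i3 := hmul _ _ hθ.continuous hG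
    have i4 : IntegrableOn (fun t => deriv θ t * A0) (Ioo 0 T) :=
      hmul _ _ hθ' (integrableOn_const (by simp))
    have p1 := hacθ.integral_deriv_mul_eq_sub hΓ
    have hΓ0 : Γ 0 = 0 := by simp [Γ]
    rw [hθT, hΓ0, zero_mul, mul_zero, sub_zero, intervalIntegral.integral_of_le hT.le,
      integral_Ioc_eq_integral_Ioo] at p1
    have p2 : ∫ t in Ioo 0 T, (deriv θ t * Γ t + θ t * deriv Γ t) =
        ∫ t in Ioo 0 T, (deriv θ t * Γ t + θ t * G t) := by
      refine integral_congr_ae ?_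
      filter_upwards [ae_restrict_of_ae hGi.ae_hasDerivAt_integral,
        ae_restrict_mem measurableSet_Ioo] with t ht htm
      have : HasDerivAt Γ (G t) t :=
        ht (by rw [uIcc_of_le hT.le]; exact Ioo_subset_Icc_self htm) 0 (by simp)
      simp only [this.deriv]
    rw [p2, integral_add i2 i3] at p1
    have p3 := hacθ.integral_deriv_eq_sub
    rw [hθT, intervalIntegral.integral_of_le hT.le, integral_Ioc_eq_integral_Ioo] at p3
    have p4 : ∫ t in Ioo 0 T, deriv θ t * H0 t = (∫ t in Ioo 0 T, deriv θ t * A t)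
        - (∫ t in Ioo 0 T, deriv θ t * A0) + ∫ t in Ioo 0 T, deriv θ t * Γ t := by
      rw [← integral_sub i1 i4, ← integral_add
        (f := fun t => deriv θ t * A t - deriv θ t * A0) (i1.sub i4) i2]
      refine integral_congr_ae (Eventually.of_forall fun t => ?_)
      simp only [H0]; ring
    rw [p4, integral_mul_const, p3]
    linarith
  let φ : ℕ → ContDiffBump (0 : ℝ) := fun n =>
    { rIn := 1 / ((n:ℝ) + 1)
      rOut := 2 * (1 / ((n:ℝ) + 1))
      rIn_pos := by positivity
      rIn_lt_rOut := by have : 0 < 1 / ((n:ℝ) + 1) := by positivity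
                        linarith }
  have hφ : Tendsto (fun n => (φ n).rOut) atTop (𝓝 0) := by
    have := (tendsto_one_div_add_atTop_nhds_zero_nat (𝕜 := ℝ)).const_mul 2
    simpa [φ] using this
  have hlim := ContDiffBump.ae_convolution_tendsto_right_of_locallyIntegrable (φ := φ) (K := 2)
      hφ (Eventually.of_forall fun n => le_rfl) hH.locallyIntegrable
  filter_upwards [ae_restrict_of_ae hlim, ae_restrict_mem measurableSet_Ioo] with s hs hsm
  have hle : H s ≤ 0 := by
    refine le_of_tendsto hs ?_
    have hpos : 0 < min s (T - s) := lt_min hsm.1 (by linarith [hsm.2])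
    filter_upwards [hφ.eventually (gt_mem_nhds hpos)] with n hn
    have hr1 : (φ n).rOut < s := hn.trans_le (min_le_left _ _)
    have hr2 : (φ n).rOut < T - s := hn.trans_le (min_le_right _ _)
    rw [convolution_eq_swap]
    let g : ℝ → ℝ := fun t => (φ n).normed volume (s - t)
    have hg : ContDiff ℝ (⊤:ℕ∞) g := (φ n).contDiff_normed.comp (by fun_prop)
    have hgn : ∀ t, 0 ≤ g t := fun t => (φ n).nonneg_normed _
    have hg0 : ∀ t, s + (φ n).rOut ≤ t → g t = 0 := by
      intro t ht
      have : (s - t) ∉ Function.support ((φ n).normed volume) := by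
        rw [(φ n).support_normed_eq, Metric.mem_ball, dist_zero_right, Real.norm_eq_abs, not_lt]
        rw [abs_sub_comm]
        exact (by linarith : (φ n).rOut ≤ t - s).trans (le_abs_self _)
      simpa using this
    let θ : ℝ → ℝ := fun t => ∫ r in t..T, g r
    have hθd : ∀ t, HasDerivAt θ (- g t) t := fun t =>
      intervalIntegral.integral_hasDerivAt_left (hg.continuous.intervalIntegrable _ _)
        (hg.continuous.stronglyMeasurableAtFilter _ _) hg.continuous.continuousAt
    have hθd' : deriv θ = fun t => - g t := funext fun t => (hθd t).deriv
    have hθz : ∀ t, s + (φ n).rOut ≤ t → θ t = 0 := by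
      intro t ht
      have : EqOn g 0 (uIcc t T) := by
        intro r hr
        refine hg0 r (le_trans ?_ hr.1)
        exact le_inf ht (by linarith)
      simp only [θ]
      rw [intervalIntegral.integral_congr this]; simp
    have hk := key θ ?_ ?_ ⟨s + (φ n).rOut, by linarith, hθz⟩
    · have e : ∫ t, ((ContinuousLinearMap.lsmul ℝ ℝ) ((φ n).normed volume (s - t))) (H t)
          = - ∫ t in Ioo 0 T, deriv θ t * H0 t := by
        rw [← integral_neg, ← integral_indicator measurableSet_Ioo]
        refine integral_congr_ae (Eventually.of_forall fun t => ?_)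
        by_cases ht : t ∈ Ioo 0 T
        · simp [H, ht, hθd', g]
        · simp [H, ht]
      rw [e]; linarith
    · rw [contDiff_infty_iff_deriv]
      refine ⟨fun t => (hθd t).differentiableAt, ?_⟩
      rw [hθd']; exact hg.neg
    · intro t
      by_cases ht : t ≤ T
      · exact intervalIntegral.integral_nonneg ht fun r _ => hgn r
      · exact (hθz t (by linarith)).ge
  simp only [H, indicator_of_mem hsm, H0, Γ] at hle
  rw [intervalIntegral.integral_of_le hsm.1.le, integral_Ioc_eq_integral_Ioo] at hle
  linarith


theorem aux_symm_eta {E : Type*} [NormedAddCommGroup E] [NormedSpace ℝ E]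
    {η : E → ℝ} (hη : ContDiff ℝ 2 η) (z a b : E) :
    fderiv ℝ (fderiv ℝ η) z a b = fderiv ℝ (fderiv ℝ η) z b a := by
  have := (hη.contDiffAt (x := z)).isSymmSndFDerivAt (by simp)
  exact this a b

theorem aux_compat {E : Type*} [NormedAddCommGroup E] [NormedSpace ℝ E]
    {f : E → E} {η q : E → ℝ} (hf : ContDiff ℝ 2 f) (hη : ContDiff ℝ 2 η) (hq : ContDiff ℝ 2 q)
    (hcompat : ∀ w, fderiv ℝ q w = (fderiv ℝ η w).comp (fderiv ℝ f w)) (z a b : E) :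
    fderiv ℝ (fderiv ℝ η) z a (fderiv ℝ f z b) = fderiv ℝ (fderiv ℝ η) z b (fderiv ℝ f z a) := by
  have hsq := (hq.contDiffAt (x := z)).isSymmSndFDerivAt (by simp) a b
  have hsf := (hf.contDiffAt (x := z)).isSymmSndFDerivAt (by simp) a b
  have d1 : HasFDerivAt (fderiv ℝ η) (fderiv ℝ (fderiv ℝ η) z) z :=
    ((hη.fderiv_right (m := 1) (by norm_num)).differentiable (by simp) z).hasFDerivAt
  have d2 : HasFDerivAt (fderiv ℝ f) (fderiv ℝ (fderiv ℝ f) z) z :=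
    ((hf.fderiv_right (m := 1) (by norm_num)).differentiable (by simp) z).hasFDerivAt
  have d3 := d1.clm_comp d2
  have e : fderiv ℝ q = fun w => (fderiv ℝ η w).comp (fderiv ℝ f w) := funext hcompat
  rw [e, d3.fderiv] at hsq
  simp at hsq
  rw [hsf] at hsq
  linarith

theorem aux_K0 {E : Type*} [NormedAddCommGroup E] [NormedSpace ℝ E]
    {η : E → ℝ} (hη : ContDiff ℝ 2 η) (z h : E) :
    DifferentiableAt ℝ (fun z => η z - fderiv ℝ η z z) z ∧
    fderiv ℝ (fun z => η z - fderiv ℝ η z z) z h = - fderiv ℝ (fderiv ℝ η) z h z := by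
  have d0 : HasFDerivAt η (fderiv ℝ η z) z := (hη.differentiable (by simp) z).hasFDerivAt
  have d1 : HasFDerivAt (fderiv ℝ η) (fderiv ℝ (fderiv ℝ η) z) z :=
    ((hη.fderiv_right (m := 1) (by norm_num)).differentiable (by simp) z).hasFDerivAt
  have d := d0.fun_sub (d1.clm_apply (hasFDerivAt_id z))
  refine ⟨d.differentiableAt, ?_⟩
  have e := d.fderiv
  simp only [id] at e
  rw [e]; simp

theorem aux_P0 {E : Type*} [NormedAddCommGroup E] [NormedSpace ℝ E]
    {f : E → E} {η q : E → ℝ} (hf : ContDiff ℝ 2 f) (hη : ContDiff ℝ 2 η) (hq : ContDiff ℝ 2 q)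
    (hcompat : ∀ w, fderiv ℝ q w = (fderiv ℝ η w).comp (fderiv ℝ f w)) (z h : E) :
    DifferentiableAt ℝ (fun z => fderiv ℝ η z (f z) - q z) z ∧
    fderiv ℝ (fun z => fderiv ℝ η z (f z) - q z) z h = fderiv ℝ (fderiv ℝ η) z h (f z) := by
  have d0 : HasFDerivAt q (fderiv ℝ q z) z := (hq.differentiable (by simp) z).hasFDerivAt
  have df : HasFDerivAt f (fderiv ℝ f z) z := (hf.differentiable (by simp) z).hasFDerivAt
  have d1 : HasFDerivAt (fderiv ℝ η) (fderiv ℝ (fderiv ℝ η) z) z :=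
    ((hη.fderiv_right (m := 1) (by norm_num)).differentiable (by simp) z).hasFDerivAt
  have d := (d1.clm_apply df).fun_sub d0
  refine ⟨d.differentiableAt, ?_⟩
  rw [d.fderiv, hcompat]; simp

open Filter Topology in
theorem aux_core {E : Type*} [NormedAddCommGroup E] [InnerProductSpace ℝ E] [FiniteDimensional ℝ E]
    {T : ℝ} (hT : 0 < T) (f : E → E) (η q : E → ℝ)
    (hf : ContDiff ℝ 2 f) (hη : ContDiff ℝ 2 η) (hq : ContDiff ℝ 2 q)
    (hcompat : ∀ w, fderiv ℝ q w = (fderiv ℝ η w).comp (fderiv ℝ f w))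
    (u : ℝ → ℝ → E) (u₀ : ℝ → E)
    (hu_meas : AEStronglyMeasurable (fun p : ℝ × ℝ => u p.1 p.2)
      ((volume.restrict (Ioo 0 T)).prod (volume.restrict (Ioo (0:ℝ) 1))))
    (hu0_meas : AEStronglyMeasurable u₀ (volume.restrict (Ioo (0:ℝ) 1)))
    {C : Set E} (hC : IsCompact C)
    (huC : ∀ᵐ p ∂((volume.restrict (Ioo 0 T)).prod (volume.restrict (Ioo (0:ℝ) 1))),
      u p.1 p.2 ∈ C)
    (hu0_bdd : ∃ M : ℝ, ∀ᵐ x ∂(volume.restrict (Ioo (0:ℝ) 1)), ‖u₀ x‖ ≤ M)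
    (hweak : ∀ φ : ℝ → ℝ → E,
      ContDiff ℝ (⊤:ℕ∞) (fun p : ℝ × ℝ => φ p.1 p.2) →
      (∀ t x, φ t (x + 1) = φ t x) →
      (∃ t₀ < T, ∀ t, t₀ ≤ t → ∀ x, φ t x = 0) →
      (∫ t in Ioo 0 T, ∫ x in Ioo (0:ℝ) 1,
          (⟪u t x, deriv (fun s => φ s x) t⟫ + ⟪f (u t x), deriv (fun y => φ t y) x⟫))
        + (∫ x in Ioo (0:ℝ) 1, ⟪u₀ x, φ 0 x⟫) = 0)
    (hentropy : ∀ φ : ℝ → ℝ → ℝ,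
      ContDiff ℝ (⊤:ℕ∞) (fun p : ℝ × ℝ => φ p.1 p.2) →
      (∀ t x, φ t (x + 1) = φ t x) →
      (∀ t x, 0 ≤ φ t x) →
      (∃ t₀ < T, ∀ t, t₀ ≤ t → ∀ x, φ t x = 0) →
      0 ≤ (∫ t in Ioo 0 T, ∫ x in Ioo (0:ℝ) 1,
            (η (u t x) * deriv (fun s => φ s x) t + q (u t x) * deriv (fun y => φ t y) x))
          + ∫ x in Ioo (0:ℝ) 1, η (u₀ x) * φ 0 x)
    (V : ℝ × ℝ → E) (L : NNReal) (hV : LipschitzWith L V) (BV : ℝ) (hBV : ∀ p, ‖V p‖ ≤ BV)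
    (hper : ∀ t x, V (t, x + 1) = V (t, x)) :
    ∀ᵐ s ∂(volume.restrict (Ioo 0 T)),
      (∫ x in Ioo (0:ℝ) 1,
          (η (u s x) - η (V (s, x)) - fderiv ℝ η (V (s, x)) (u s x - V (s, x))))
        ≤ - (∫ t in Ioo 0 s, ∫ x in Ioo (0:ℝ) 1,
              fderiv ℝ (fderiv ℝ η) (V (t, x))
                (f (u t x) - f (V (t, x)) - fderiv ℝ f (V (t, x)) (u t x - V (t, x)))
                (fderiv ℝ V (t, x) (0, 1)))
          - (∫ t in Ioo 0 s, ∫ x in Ioo (0:ℝ) 1,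
              fderiv ℝ (fderiv ℝ η) (V (t, x)) (u t x - V (t, x))
                (fderiv ℝ V (t, x) (1, 0) + fderiv ℝ f (V (t, x)) (fderiv ℝ V (t, x) (0, 1))))
          + ∫ x in Ioo (0:ℝ) 1,
              (η (u₀ x) - η (V (0, x)) - fderiv ℝ η (V (0, x)) (u₀ x - V (0, x))) := by
  borelize E
  have : CompleteSpace E := FiniteDimensional.complete ℝ E
  set μ := (volume.restrict (Ioo 0 T)).prod (volume.restrict (Ioo (0:ℝ) 1)) with hμ
  have cη := hη.continuous
  have cf := hf.continuous
  have cDη : Continuous (fderiv ℝ η) := hη.continuous_fderiv (by simp)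
  have cDf : Continuous (fderiv ℝ f) := hf.continuous_fderiv (by simp)
  have hDη1 : ContDiff ℝ 1 (fderiv ℝ η) := hη.fderiv_right (m := 1) (by norm_num)
  have cD2 : Continuous (fderiv ℝ (fderiv ℝ η)) := hDη1.continuous_fderiv (by simp)
  have hmem : ∀ᵐ p ∂μ, p.1 ∈ Icc 0 T := by
    rw [hμ, Measure.prod_restrict]
    filter_upwards [ae_restrict_mem (measurableSet_Ioo.prod measurableSet_Ioo)] with p hp
    exact Ioo_subset_Icc_self hp.1
  have habs : μ ≪ (volume : Measure (ℝ × ℝ)) := by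
    rw [hμ, Measure.prod_restrict, ← Measure.volume_eq_prod]
    exact Measure.absolutelyContinuous_of_le Measure.restrict_le_self
  have hn1 : ‖((1:ℝ), (0:ℝ))‖ = 1 := by simp [Prod.norm_def]
  have hn2 : ‖((0:ℝ), (1:ℝ))‖ = 1 := by simp [Prod.norm_def]
  have hA1 : ∀ p, ‖fderiv ℝ V p (1, 0)‖ ≤ L := fun p => by
    have := (fderiv ℝ V p).le_opNorm (1, 0)
    rw [hn1, mul_one] at this; exact this.trans (norm_fderiv_le_of_lipschitz ℝ hV)
  have hA2 : ∀ p, ‖fderiv ℝ V p (0, 1)‖ ≤ L := fun p => by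
    have := (fderiv ℝ V p).le_opNorm (0, 1)
    rw [hn2, mul_one] at this; exact this.trans (norm_fderiv_le_of_lipschitz ℝ hV)
  -- the state vector
  let X : ℝ × ℝ → E × E × E × E × ℝ := fun p =>
    (u p.1 p.2, V p, fderiv ℝ V p (1, 0), fderiv ℝ V p (0, 1), p.1)
  have hXm : AEStronglyMeasurable X μ := by
    refine hu_meas.prodMk (hV.continuous.aestronglyMeasurable.prodMk
      ((measurable_fderiv_apply_const ℝ V (1, 0)).aestronglyMeasurable.prodMk
      ((measurable_fderiv_apply_const ℝ V (0, 1)).aestronglyMeasurable.prodMk ?_)))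
    exact continuous_fst.aestronglyMeasurable
  let S : Set (E × E × E × E × ℝ) := C ×ˢ Metric.closedBall 0 BV ×ˢ
    Metric.closedBall 0 (L:ℝ) ×ˢ Metric.closedBall 0 (L:ℝ) ×ˢ Icc 0 T
  have hS : IsCompact S := hC.prod ((isCompact_closedBall _ _).prod ((isCompact_closedBall _ _).prod
    ((isCompact_closedBall _ _).prod isCompact_Icc)))
  have hXS : ∀ᵐ p ∂μ, X p ∈ S := by
    filter_upwards [huC, hmem] with p h1 h2
    exact ⟨h1, by simpa using hBV p, by simpa using hA1 p, by simpa using hA2 p, h2⟩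
  have I : ∀ Φ : E × E × E × E × ℝ → ℝ, Continuous Φ → Integrable (fun p => Φ (X p)) μ :=
    fun Φ hΦ => aux_int μ X hXm S hS hXS Φ hΦ
  have IE : ∀ Φ : E × E × E × E × ℝ → E, Continuous Φ → Integrable (fun p => Φ (X p)) μ :=
    fun Φ hΦ => aux_int μ X hXm S hS hXS Φ hΦ
  obtain ⟨M, hM⟩ := hu0_bdd
  let X0 : ℝ → E × E := fun x => (u₀ x, V (0, x))
  have cV0 : Continuous (fun x : ℝ => V (0, x)) := hV.continuous.comp (by fun_prop)
  have hX0m : AEStronglyMeasurable X0 (volume.restrict (Ioo (0:ℝ) 1)) :=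
    hu0_meas.prodMk cV0.aestronglyMeasurable
  have hX0S : ∀ᵐ x ∂(volume.restrict (Ioo (0:ℝ) 1)),
      X0 x ∈ Metric.closedBall (0:E) M ×ˢ Metric.closedBall (0:E) BV := by
    filter_upwards [hM] with x hx
    exact ⟨by simpa using hx, by simpa using hBV _⟩
  have I0 : ∀ Φ : E × E → ℝ, Continuous Φ →
      Integrable (fun x => Φ (X0 x)) (volume.restrict (Ioo (0:ℝ) 1)) :=
    fun Φ hΦ => aux_int _ X0 hX0m _ ((isCompact_closedBall _ _).prod (isCompact_closedBall _ _))
      hX0S Φ hΦ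
  have hu0i : Integrable u₀ (volume.restrict (Ioo (0:ℝ) 1)) := Integrable.of_bound hu0_meas M hM
  have hui : Integrable (fun p : ℝ × ℝ => u p.1 p.2) μ := IE (fun y => y.1) (by fun_prop)
  have hfui : Integrable (fun p : ℝ × ℝ => f (u p.1 p.2)) μ := IE (fun y => f y.1) (by fun_prop)
  -- Lipschitz compositions
  let W : ℝ × ℝ → E := fun p => (InnerProductSpace.toDual ℝ E).symm (fderiv ℝ η (V p))
  have hWin : ∀ p a, ⟪a, W p⟫ = fderiv ℝ η (V p) a := fun p a => by
    rw [real_inner_comm]; exact InnerProductSpace.toDual_symm_apply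
  obtain ⟨KW, hKW⟩ := aux_lip_comp V L hV BV hBV (fderiv ℝ η) hDη1
  have hWl : LipschitzWith (1 * KW) W :=
    (InnerProductSpace.toDual ℝ E).symm.isometry.lipschitz.comp hKW
  obtain ⟨BW, hBW'⟩ := (isCompact_closedBall (0:E) BV).exists_bound_of_continuousOn cDη.continuousOn
  have hBW : ∀ p, ‖W p‖ ≤ BW := fun p => by
    simp only [W, LinearIsometryEquiv.norm_map]
    exact hBW' _ (by simpa using hBV p)
  have hWper : ∀ t x, W (t, x + 1) = W (t, x) := fun t x => by simp only [W, hper]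
  have cK0 : ContDiff ℝ 1 (fun z => η z - fderiv ℝ η z z) :=
    (hη.of_le (by norm_num)).sub (hDη1.clm_apply contDiff_id)
  have cP0 : ContDiff ℝ 1 (fun z => fderiv ℝ η z (f z) - q z) :=
    (hDη1.clm_apply (hf.of_le (by norm_num))).sub (hq.of_le (by norm_num))
  obtain ⟨KK, hKK⟩ := aux_lip_comp V L hV BV hBV _ cK0
  obtain ⟨KP, hKP⟩ := aux_lip_comp V L hV BV hBV _ cP0
  have hVd : ∀ᵐ p ∂μ, DifferentiableAt ℝ V p := habs.ae_le hV.ae_differentiableAt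
  have hWd : ∀ᵐ p ∂μ, DifferentiableAt ℝ W p := habs.ae_le hWl.ae_differentiableAt
  have hWe : ∀ᵐ p ∂μ, ∀ a h, ⟪a, fderiv ℝ W p h⟫
      = fderiv ℝ (fderiv ℝ η) (V p) (fderiv ℝ V p h) a := by
    filter_upwards [hVd, hWd] with p h1 h2 a h
    have d1 : HasFDerivAt (fderiv ℝ η) (fderiv ℝ (fderiv ℝ η) (V p)) (V p) :=
      (hDη1.differentiable (by simp) (V p)).hasFDerivAt
    have e1 := (hasFDerivAt_const a p).inner ℝ h2.hasFDerivAt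
    have e2 := (d1.comp p h1.hasFDerivAt).clm_apply (hasFDerivAt_const a p)
    have e3 : (fun t => ⟪a, W t⟫) = fun y => (fderiv ℝ η ∘ V) y a := funext fun p => hWin p a
    rw [e3] at e1
    have e4 := congrArg (fun l => l h) (e1.unique e2)
    simpa using e4
  have hKe : ∀ᵐ p ∂μ, ∀ h, fderiv ℝ (fun p => η (V p) - fderiv ℝ η (V p) (V p)) p h
      = - fderiv ℝ (fderiv ℝ η) (V p) (fderiv ℝ V p h) (V p) := by
    filter_upwards [hVd] with p h1 h
    have e := ((aux_K0 hη (V p) 0).1.hasFDerivAt.comp p h1.hasFDerivAt).fderiv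
    simp only [Function.comp_def] at e
    rw [e, ContinuousLinearMap.comp_apply]
    exact (aux_K0 hη (V p) _).2
  have hPe : ∀ᵐ p ∂μ, ∀ h, fderiv ℝ (fun p => fderiv ℝ η (V p) (f (V p)) - q (V p)) p h
      = fderiv ℝ (fderiv ℝ η) (V p) (fderiv ℝ V p h) (f (V p)) := by
    filter_upwards [hVd] with p h1 h
    have e := ((aux_P0 hf hη hq hcompat (V p) 0).1.hasFDerivAt.comp p h1.hasFDerivAt).fderiv
    simp only [Function.comp_def] at e
    rw [e, ContinuousLinearMap.comp_apply]
    exact (aux_P0 hf hη hq hcompat (V p) _).2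
  let rel : ℝ × ℝ → ℝ := fun p =>
    η (u p.1 p.2) - η (V p) - fderiv ℝ η (V p) (u p.1 p.2 - V p)
  let g1 : ℝ × ℝ → ℝ := fun p => fderiv ℝ (fderiv ℝ η) (V p)
    (f (u p.1 p.2) - f (V p) - fderiv ℝ f (V p) (u p.1 p.2 - V p)) (fderiv ℝ V p (0, 1))
  let g2 : ℝ × ℝ → ℝ := fun p => fderiv ℝ (fderiv ℝ η) (V p) (u p.1 p.2 - V p)
    (fderiv ℝ V p (1, 0) + fderiv ℝ f (V p) (fderiv ℝ V p (0, 1)))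
  have irel : Integrable rel μ :=
    I (fun y => η y.1 - η y.2.1 - fderiv ℝ η y.2.1 (y.1 - y.2.1)) (by fun_prop)
  have ig1 : Integrable g1 μ :=
    I (fun y => fderiv ℝ (fderiv ℝ η) y.2.1 (f y.1 - f y.2.1 - fderiv ℝ f y.2.1 (y.1 - y.2.1))
      y.2.2.2.1) (by fun_prop)
  have ig2 : Integrable g2 μ :=
    I (fun y => fderiv ℝ (fderiv ℝ η) y.2.1 (y.1 - y.2.1)
      (y.2.2.1 + fderiv ℝ f y.2.1 y.2.2.2.1)) (by fun_prop)
  have main := aux_final hT (fun t => ∫ x in Ioo (0:ℝ) 1, rel (t, x))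
    (fun t => (∫ x in Ioo (0:ℝ) 1, g1 (t, x)) + ∫ x in Ioo (0:ℝ) 1, g2 (t, x))
    (∫ x in Ioo (0:ℝ) 1, (η (u₀ x) - η (V (0, x)) - fderiv ℝ η (V (0, x)) (u₀ x - V (0, x))))
    irel.integral_prod_left (ig1.integral_prod_left.add ig2.integral_prod_left) ?_
  · filter_upwards [main, ae_restrict_mem measurableSet_Ioo] with s hs hsm
    have sub : Ioo 0 s ⊆ Ioo 0 T := Ioo_subset_Ioo_right hsm.2.le
    rw [integral_add (IntegrableOn.mono_set ig1.integral_prod_left sub)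
      (IntegrableOn.mono_set ig2.integral_prod_left sub)] at hs
    simp only [rel, g1, g2] at hs
    linarith
  · intro θ hθ hθn hθ0
    have hθT : θ T = 0 := by
      obtain ⟨t₀, h1, h2⟩ := hθ0; exact h2 T h1.le
    have cθ := hθ.continuous
    have cθ' : Continuous (deriv θ) := hθ.continuous_deriv (by simp)
    have iθrel : Integrable (fun p => deriv θ p.1 * rel p) μ :=
      I (fun y => deriv θ y.2.2.2.2 * (η y.1 - η y.2.1 - fderiv ℝ η y.2.1 (y.1 - y.2.1)))
        (by fun_prop)
    have iθg1 : Integrable (fun p => θ p.1 * g1 p) μ :=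
      I (fun y => θ y.2.2.2.2 * fderiv ℝ (fderiv ℝ η) y.2.1
        (f y.1 - f y.2.1 - fderiv ℝ f y.2.1 (y.1 - y.2.1)) y.2.2.2.1) (by fun_prop)
    have iθg2 : Integrable (fun p => θ p.1 * g2 p) μ :=
      I (fun y => θ y.2.2.2.2 * fderiv ℝ (fderiv ℝ η) y.2.1 (y.1 - y.2.1)
        (y.2.2.1 + fderiv ℝ f y.2.1 y.2.2.2.1)) (by fun_prop)
    have iη : Integrable (fun p : ℝ × ℝ => η (u p.1 p.2) * deriv θ p.1) μ :=
      I (fun y => η y.1 * deriv θ y.2.2.2.2) (by fun_prop)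
    let Kf : ℝ × ℝ → ℝ := fun p => deriv θ p.1 * (η (V p) - fderiv ℝ η (V p) (V p))
        + θ p.1 * fderiv ℝ (fun p => η (V p) - fderiv ℝ η (V p) (V p)) p (1, 0)
    have iK : Integrable Kf μ := by
      refine (I (fun y => deriv θ y.2.2.2.2 * (η y.2.1 - fderiv ℝ η y.2.1 y.2.1)
        + θ y.2.2.2.2 * (- fderiv ℝ (fderiv ℝ η) y.2.1 y.2.2.1 y.2.1)) (by fun_prop)).congr ?_
      filter_upwards [hKe] with p hp
      simp only [Kf, hp]; rfl
    let Pf : ℝ × ℝ → ℝ := fun p =>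
      θ p.1 * fderiv ℝ (fun p => fderiv ℝ η (V p) (f (V p)) - q (V p)) p (0, 1)
    have iP : Integrable Pf μ := by
      refine (I (fun y => θ y.2.2.2.2 * (fderiv ℝ (fderiv ℝ η) y.2.1 y.2.2.2.1 (f y.2.1)))
        (by fun_prop)).congr ?_
      filter_upwards [hPe] with p hp
      simp only [Pf, hp]; rfl
    let Wf : ℝ × ℝ → ℝ := fun p =>
      ⟪u p.1 p.2, deriv θ p.1 • W p + θ p.1 • fderiv ℝ W p (1, 0)⟫
        + ⟪f (u p.1 p.2), θ p.1 • fderiv ℝ W p (0, 1)⟫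
    have hWf : ∀ᵐ p ∂μ, Wf p = deriv θ p.1 * fderiv ℝ η (V p) (u p.1 p.2)
        + θ p.1 * fderiv ℝ (fderiv ℝ η) (V p) (fderiv ℝ V p (1, 0)) (u p.1 p.2)
        + θ p.1 * fderiv ℝ (fderiv ℝ η) (V p) (fderiv ℝ V p (0, 1)) (f (u p.1 p.2)) := by
      filter_upwards [hWe] with p hp
      simp only [Wf, inner_add_right, inner_smul_right, hp, hWin]
    have iW : Integrable Wf μ := by
      refine (I (fun y => deriv θ y.2.2.2.2 * fderiv ℝ η y.2.1 y.1
        + θ y.2.2.2.2 * fderiv ℝ (fderiv ℝ η) y.2.1 y.2.2.1 y.1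
        + θ y.2.2.2.2 * fderiv ℝ (fderiv ℝ η) y.2.1 y.2.2.2.1 (f y.1)) (by fun_prop)).congr ?_
      filter_upwards [hWf] with p hp
      rw [hp]
    -- the four identities
    have q1 : ∫ p, Wf p ∂μ + ∫ x in Ioo (0:ℝ) 1, ⟪u₀ x, θ 0 • W (0, x)⟫ = 0 :=
      aux_weak (fun p => u p.1 p.2) (fun p => f (u p.1 p.2)) u₀ hui hfui hu0i hweak θ hθ hθ0
        W _ hWl BW hBW hWper
    have q2 : ∫ p, Kf p ∂μ = - ∫ x in Ioo (0:ℝ) 1,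
        θ 0 * (η (V (0, x)) - fderiv ℝ η (V (0, x)) (V (0, x))) :=
      aux_t hT θ hθ hθT (fun p => η (V p) - fderiv ℝ η (V p) (V p)) KK hKK iK
    have q3 : ∫ p, Pf p ∂μ = 0 :=
      aux_x θ (fun p => fderiv ℝ η (V p) (f (V p)) - q (V p)) KP hKP
        (fun t x => by simp only [hper]) iP
    have q4 : 0 ≤ ∫ p, η (u p.1 p.2) * deriv θ p.1 ∂μ
        + ∫ x in Ioo (0:ℝ) 1, η (u₀ x) * θ 0 := by
      have := hentropy (fun t _ => θ t) (hθ.comp contDiff_fst) (fun _ _ => rfl)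
        (fun t _ => hθn t) (by
          obtain ⟨t₀, h1, h2⟩ := hθ0
          exact ⟨t₀, h1, fun t ht _ => h2 t ht⟩)
      rw [hμ, integral_prod (fun p : ℝ × ℝ => η (u p.1 p.2) * deriv θ p.1) iη]
      simpa using this
    -- combination
    have comb : ∫ p, deriv θ p.1 * rel p ∂μ = ∫ p, η (u p.1 p.2) * deriv θ p.1 ∂μ
        - ∫ p, Kf p ∂μ - ∫ p, Wf p ∂μ + ∫ p, Pf p ∂μ
        + (∫ p, θ p.1 * g1 p ∂μ + ∫ p, θ p.1 * g2 p ∂μ) := by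
      rw [← integral_sub' iη iK, ← integral_sub' (iη.sub iK) iW,
        ← integral_add' ((iη.sub iK).sub iW) iP, ← integral_add' iθg1 iθg2,
        ← integral_add' (((iη.sub iK).sub iW).add iP) (iθg1.add iθg2)]
      refine integral_congr_ae ?_
      filter_upwards [hWf, hKe, hPe] with p h1 h2 h3
      simp only [Pi.add_apply, Pi.sub_apply, h1, Kf, Pf, h2, h3, rel, g1, g2]
      rw [aux_symm_eta hη (V p) (f _ - _ - _), map_add, aux_symm_eta hη (V p) _ (fderiv ℝ V p (1, 0)),
        aux_compat hf hη hq hcompat (V p) _ (fderiv ℝ V p (0, 1))]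
      simp only [map_sub]
      ring
    have f1 : ∫ p, deriv θ p.1 * rel p ∂μ
        = ∫ t in Ioo 0 T, deriv θ t * ∫ x in Ioo (0:ℝ) 1, rel (t, x) := by
      rw [hμ, integral_prod _ iθrel]
      simp only [integral_const_mul]
    have f2 : ∫ p, θ p.1 * g1 p ∂μ
        = ∫ t in Ioo 0 T, θ t * ∫ x in Ioo (0:ℝ) 1, g1 (t, x) := by
      rw [hμ, integral_prod _ iθg1]
      simp only [integral_const_mul]
    have f3 : ∫ p, θ p.1 * g2 p ∂μ
        = ∫ t in Ioo 0 T, θ t * ∫ x in Ioo (0:ℝ) 1, g2 (t, x) := by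
      rw [hμ, integral_prod _ iθg2]
      simp only [integral_const_mul]
    have j1 : Integrable (fun t => θ t * ∫ x in Ioo (0:ℝ) 1, g1 (t, x))
        (volume.restrict (Ioo 0 T)) := by
      have := iθg1.integral_prod_left
      simpa only [integral_const_mul] using this
    have j2 : Integrable (fun t => θ t * ∫ x in Ioo (0:ℝ) 1, g2 (t, x))
        (volume.restrict (Ioo 0 T)) := by
      have := iθg2.integral_prod_left
      simpa only [integral_const_mul] using this
    have f4 : ∫ t in Ioo 0 T, θ t * ((∫ x in Ioo (0:ℝ) 1, g1 (t, x))
        + ∫ x in Ioo (0:ℝ) 1, g2 (t, x)) = ∫ p, θ p.1 * g1 p ∂μ + ∫ p, θ p.1 * g2 p ∂μ := by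
      rw [f2, f3, ← integral_add j1 j2]
      simp only [mul_add]
    have k1 : Integrable (fun x => η (u₀ x)) (volume.restrict (Ioo (0:ℝ) 1)) :=
      I0 (fun y => η y.1) (by fun_prop)
    have k2 : Integrable (fun x => η (V (0, x)) - fderiv ℝ η (V (0, x)) (V (0, x)))
        (volume.restrict (Ioo (0:ℝ) 1)) :=
      I0 (fun y => η y.2 - fderiv ℝ η y.2 y.2) (by fun_prop)
    have k3 : Integrable (fun x => fderiv ℝ η (V (0, x)) (u₀ x))
        (volume.restrict (Ioo (0:ℝ) 1)) :=
      I0 (fun y => fderiv ℝ η y.2 y.1) (by fun_prop)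
    have f5 : ∫ x in Ioo (0:ℝ) 1,
        (η (u₀ x) - η (V (0, x)) - fderiv ℝ η (V (0, x)) (u₀ x - V (0, x)))
        = (∫ x in Ioo (0:ℝ) 1, η (u₀ x))
          - (∫ x in Ioo (0:ℝ) 1, (η (V (0, x)) - fderiv ℝ η (V (0, x)) (V (0, x))))
          - ∫ x in Ioo (0:ℝ) 1, fderiv ℝ η (V (0, x)) (u₀ x) := by
      rw [← integral_sub' k1 k2, ← integral_sub' (k1.sub k2) k3]
      refine integral_congr_ae (Eventually.of_forall fun x => ?_)
      simp only [Pi.sub_apply, map_sub]; ring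
    simp only [inner_smul_right, hWin] at q1
    rw [integral_const_mul] at q1 q2
    rw [integral_mul_const] at q4
    rw [f4, ← f1, f5, comb]
    linarith

/-- Pre-Gronwall relative entropy inequality.  For a bounded entropy weak
solution `u` (values a.e. in a compact set `C`) with initial data `u₀` and a Lipschitz
reconstruction `v` with square-integrable residual `R = ∂_t v + ∂_x f(v)` (spatial domain:
`(0,1)` periodic, functions encoded as `1`-periodic functions on `ℝ`; `Vx` denotes the
a.e.-defined spatial derivative `∂_x v`), for a.e. `s ∈ (0,T)`:
`∫_D η(u(s)|v(s)) ≤ − ∫_0^s∫_D f(u|v)·(D²η(v) ∂_x v) − ∫_0^s∫_D (u−v)·(D²η(v) R)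
  + ∫_D η(u₀|v(0,·))`. -/
theorem stmt3 {m : ℕ} {T : ℝ} (hT : 0 < T)
    (f : EuclideanSpace ℝ (Fin m) → EuclideanSpace ℝ (Fin m))
    (η q : EuclideanSpace ℝ (Fin m) → ℝ)
    (hf : ContDiff ℝ 2 f) (hη : ContDiff ℝ 2 η) (hq : ContDiff ℝ 2 q)
    (hηconv : ∀ v ξ : EuclideanSpace ℝ (Fin m), ξ ≠ 0 → 0 < fderiv ℝ (fderiv ℝ η) v ξ ξ)
    (hcompat : ∀ w, fderiv ℝ q w = (fderiv ℝ η w).comp (fderiv ℝ f w))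
    (u : ℝ → ℝ → EuclideanSpace ℝ (Fin m)) (u₀ : ℝ → EuclideanSpace ℝ (Fin m))
    (hu_meas : AEStronglyMeasurable (fun p : ℝ × ℝ => u p.1 p.2)
      ((volume.restrict (Ioo 0 T)).prod (volume.restrict (Ioo (0:ℝ) 1))))
    (hu0_meas : AEStronglyMeasurable u₀ (volume.restrict (Ioo (0:ℝ) 1)))
    {C : Set (EuclideanSpace ℝ (Fin m))} (hC : IsCompact C)
    (huC : ∀ᵐ p ∂((volume.restrict (Ioo 0 T)).prod (volume.restrict (Ioo (0:ℝ) 1))),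
      u p.1 p.2 ∈ C)
    (hu0_bdd : ∃ M : ℝ, ∀ᵐ x ∂(volume.restrict (Ioo (0:ℝ) 1)), ‖u₀ x‖ ≤ M)
    (hweak : ∀ φ : ℝ → ℝ → EuclideanSpace ℝ (Fin m),
      ContDiff ℝ (⊤:ℕ∞) (fun p : ℝ × ℝ => φ p.1 p.2) →
      (∀ t x, φ t (x + 1) = φ t x) →
      (∃ t₀ < T, ∀ t, t₀ ≤ t → ∀ x, φ t x = 0) →
      (∫ t in Ioo 0 T, ∫ x in Ioo (0:ℝ) 1,
          (⟪u t x, deriv (fun s => φ s x) t⟫ + ⟪f (u t x), deriv (fun y => φ t y) x⟫))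
        + (∫ x in Ioo (0:ℝ) 1, ⟪u₀ x, φ 0 x⟫) = 0)
    (hentropy : ∀ φ : ℝ → ℝ → ℝ,
      ContDiff ℝ (⊤:ℕ∞) (fun p : ℝ × ℝ => φ p.1 p.2) →
      (∀ t x, φ t (x + 1) = φ t x) →
      (∀ t x, 0 ≤ φ t x) →
      (∃ t₀ < T, ∀ t, t₀ ≤ t → ∀ x, φ t x = 0) →
      0 ≤ (∫ t in Ioo 0 T, ∫ x in Ioo (0:ℝ) 1,
            (η (u t x) * deriv (fun s => φ s x) t + q (u t x) * deriv (fun y => φ t y) x))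
          + ∫ x in Ioo (0:ℝ) 1, η (u₀ x) * φ 0 x)
    (v : ℝ → ℝ → EuclideanSpace ℝ (Fin m)) (Lv : NNReal)
    (hv_lip : LipschitzOnWith Lv (fun p : ℝ × ℝ => v p.1 p.2) (Icc 0 T ×ˢ univ))
    (hv_per : ∀ t x, v t (x + 1) = v t x)
    (Vx R : ℝ → ℝ → EuclideanSpace ℝ (Fin m))
    (hVx : ∀ᵐ p ∂((volume.restrict (Ioo 0 T)).prod (volume.restrict (Ioo (0:ℝ) 1))),
      HasDerivAt (fun y => v p.1 y) (Vx p.1 p.2) p.2)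
    (hR : ∀ᵐ p ∂((volume.restrict (Ioo 0 T)).prod (volume.restrict (Ioo (0:ℝ) 1))),
      ∃ a b : EuclideanSpace ℝ (Fin m),
        HasDerivAt (fun s => v s p.2) a p.1 ∧
        HasDerivAt (fun y => f (v p.1 y)) b p.2 ∧
        R p.1 p.2 = a + b)
    (hR_sq : Integrable (fun p : ℝ × ℝ => ‖R p.1 p.2‖ ^ 2)
      ((volume.restrict (Ioo 0 T)).prod (volume.restrict (Ioo (0:ℝ) 1)))) :
    ∀ᵐ s ∂(volume.restrict (Ioo 0 T)),
      (∫ x in Ioo (0:ℝ) 1,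
          (η (u s x) - η (v s x) - fderiv ℝ η (v s x) (u s x - v s x)))
        ≤ - (∫ t in Ioo 0 s, ∫ x in Ioo (0:ℝ) 1,
              fderiv ℝ (fderiv ℝ η) (v t x)
                (f (u t x) - f (v t x) - fderiv ℝ f (v t x) (u t x - v t x)) (Vx t x))
          - (∫ t in Ioo 0 s, ∫ x in Ioo (0:ℝ) 1,
              fderiv ℝ (fderiv ℝ η) (v t x) (u t x - v t x) (R t x))
          + ∫ x in Ioo (0:ℝ) 1,
              (η (u₀ x) - η (v 0 x) - fderiv ℝ η (v 0 x) (u₀ x - v 0 x)) := by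
  have cl : LipschitzWith 1 (fun p : ℝ × ℝ => (max 0 (min T p.1), p.2)) := by
    have h1 : LipschitzWith 1 (fun p : ℝ × ℝ => max 0 (min T p.1)) :=
      (LipschitzWith.prod_fst.const_min T).const_max 0
    simpa using h1.prodMk (LipschitzWith.prod_snd (α := ℝ) (β := ℝ))
  have cmem : ∀ t : ℝ, max 0 (min T t) ∈ Icc 0 T := fun t =>
    ⟨le_max_left _ _, max_le hT.le (min_le_left _ _)⟩
  have ceq : ∀ t ∈ Icc 0 T, max 0 (min T t) = t := fun t ht => by
    rw [min_eq_right ht.2, max_eq_right ht.1]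
  set V : ℝ × ℝ → EuclideanSpace ℝ (Fin m) := fun p => v (max 0 (min T p.1)) p.2 with hVdef
  have hVv : ∀ t ∈ Icc 0 T, ∀ x, V (t, x) = v t x := fun t ht x => by
    simp only [hVdef, ceq t ht]
  have hV : LipschitzWith Lv V := by
    refine LipschitzWith.of_dist_le_mul fun p r => ?_
    have h1 := hv_lip.dist_le_mul (max 0 (min T p.1), p.2) ⟨cmem _, mem_univ _⟩
      (max 0 (min T r.1), r.2) ⟨cmem _, mem_univ _⟩
    have h2 := cl.dist_le_mul p r
    rw [NNReal.coe_one, one_mul] at h2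
    exact h1.trans (mul_le_mul_of_nonneg_left h2 Lv.coe_nonneg)
  have hper : ∀ t x, V (t, x + 1) = V (t, x) := fun t x => hv_per _ _
  obtain ⟨BV, hBV⟩ : ∃ BV : ℝ, ∀ p, ‖V p‖ ≤ BV := by
    obtain ⟨B, hB⟩ := ((isCompact_Icc (a := (0:ℝ)) (b := T)).prod
      (isCompact_Icc (a := (0:ℝ)) (b := 1))).exists_bound_of_continuousOn
        hV.continuous.continuousOn
    refine ⟨B, fun p => ?_⟩
    have hp : Function.Periodic (fun x => V (p.1, x)) 1 := hper p.1
    have h1 : V p = V (max 0 (min T p.1), Int.fract p.2) := by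
      have h2 := hp.sub_zsmul_eq (x := p.2) ⌊p.2⌋
      simp only [zsmul_eq_mul, mul_one, Int.self_sub_floor] at h2
      have h3 : V (p.1, Int.fract p.2) = V (max 0 (min T p.1), Int.fract p.2) := by
        simp only [hVdef, ceq _ (cmem p.1)]
      rw [← h3, h2]
    rw [h1]
    exact hB _ ⟨cmem _, Int.fract_nonneg _, (Int.fract_lt_one _).le⟩
  have core := aux_core hT f η q hf hη hq hcompat u u₀ hu_meas hu0_meas hC huC hu0_bdd hweak
    hentropy V Lv hV BV hBV hper
  have hac : (volume.restrict (Ioo 0 T)).prod (volume.restrict (Ioo (0:ℝ) 1))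
      ≪ (volume : Measure (ℝ × ℝ)) := by
    rw [Measure.prod_restrict, ← Measure.volume_eq_prod]
    exact Measure.restrict_le_self.absolutelyContinuous
  have hmem : ∀ᵐ p ∂((volume.restrict (Ioo 0 T)).prod (volume.restrict (Ioo (0:ℝ) 1))),
      p.1 ∈ Ioo 0 T := by
    rw [Measure.prod_restrict]
    filter_upwards [ae_restrict_mem (measurableSet_Ioo.prod measurableSet_Ioo)] with p hp
    exact hp.1
  have hkey : ∀ᵐ p ∂((volume.restrict (Ioo 0 T)).prod (volume.restrict (Ioo (0:ℝ) 1))),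
      V p = v p.1 p.2 ∧ fderiv ℝ V p (0, 1) = Vx p.1 p.2 ∧
      fderiv ℝ V p (1, 0) + fderiv ℝ f (V p) (fderiv ℝ V p (0, 1)) = R p.1 p.2 := by
    filter_upwards [hac.ae_le hV.ae_differentiableAt, hmem, hVx, hR] with p hd hp hx hr
    obtain ⟨a, b, ha, hb, hab⟩ := hr
    have hpI : p.1 ∈ Icc 0 T := ⟨hp.1.le, hp.2.le⟩
    have e1 : V p = v p.1 p.2 := hVv p.1 hpI p.2
    have d2 : HasDerivAt (fun y => V (p.1, y)) (fderiv ℝ V p (0, 1)) p.2 := by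
      have h1 : HasDerivAt (fun y : ℝ => (p.1, y)) ((0 : ℝ), (1 : ℝ)) p.2 :=
        (hasDerivAt_const _ _).prodMk (hasDerivAt_id _)
      exact HasFDerivAt.comp_hasDerivAt p.2 (f := fun y : ℝ => (p.1, y)) hd.hasFDerivAt h1
    have d1 : HasDerivAt (fun s => V (s, p.2)) (fderiv ℝ V p (1, 0)) p.1 := by
      have h1 : HasDerivAt (fun s : ℝ => (s, p.2)) ((1 : ℝ), (0 : ℝ)) p.1 :=
        (hasDerivAt_id _).prodMk (hasDerivAt_const _ _)
      exact HasFDerivAt.comp_hasDerivAt p.1 (f := fun s : ℝ => (s, p.2)) hd.hasFDerivAt h1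
    have g2 : (fun y => V (p.1, y)) = fun y => v p.1 y := funext fun y => hVv p.1 hpI y
    rw [g2] at d2
    have e2 : fderiv ℝ V p (0, 1) = Vx p.1 p.2 := d2.unique hx
    have e3 : fderiv ℝ V p (1, 0) = a := by
      refine d1.unique (ha.congr_of_eventuallyEq ?_)
      filter_upwards [Ioo_mem_nhds hp.1 hp.2] with s hs
      exact hVv s ⟨hs.1.le, hs.2.le⟩ p.2
    have e4 : fderiv ℝ f (V p) (fderiv ℝ V p (0, 1)) = b := by
      have h1 : HasFDerivAt f (fderiv ℝ f (V p)) (v p.1 p.2) := by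
        rw [e1]; exact ((hf.differentiable (by norm_num)) _).hasFDerivAt
      have h2 : HasDerivAt (fun y => f (v p.1 y)) (fderiv ℝ f (V p) (fderiv ℝ V p (0, 1))) p.2 :=
        HasFDerivAt.comp_hasDerivAt p.2 (f := fun y => v p.1 y) h1 d2
      exact h2.unique hb
    exact ⟨e1, e2, by rw [e3, e4, hab]⟩
  have hkey2 := Measure.ae_ae_of_ae_prod hkey
  filter_upwards [core, ae_restrict_mem measurableSet_Ioo] with s hs hsI
  have hk : ∀ᵐ t ∂(volume.restrict (Ioo 0 s)), ∀ᵐ x ∂(volume.restrict (Ioo (0:ℝ) 1)),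
      V (t, x) = v t x ∧ fderiv ℝ V (t, x) (0, 1) = Vx t x ∧
      fderiv ℝ V (t, x) (1, 0) + fderiv ℝ f (V (t, x)) (fderiv ℝ V (t, x) (0, 1)) = R t x :=
    ae_restrict_of_ae_restrict_of_subset (Ioo_subset_Ioo_right hsI.2.le) hkey2
  simp only [hVv s ⟨hsI.1.le, hsI.2.le⟩, hVv 0 ⟨le_rfl, hT.le⟩] at hs
  refine hs.trans (le_of_eq ?_)
  congr 2
  · refine congrArg Neg.neg ?_
    refine integral_congr_ae ?_
    filter_upwards [hk] with t ht
    refine integral_congr_ae ?_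
    filter_upwards [ht] with x hx
    rw [hx.2.1, hx.1]
  · refine integral_congr_ae ?_
    filter_upwards [hk] with t ht
    refine integral_congr_ae ?_
    filter_upwards [ht] with x hx
    rw [hx.2.2, hx.1]
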